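/- Let α ∈ (0,1), τ > 0, a₁ < 0, and suppose 0 ≤ 2(b₁ − a₁‖N‖² + c₁k₁²τ²) < −a₁ where ‖N‖² satisfies 2‖N‖² < 1. Define H(λ) = λ + a₁ + 2(b₁ − a₁‖N‖² + c₁k₁²τ²)/E_α(−λτ^α). Then H has a unique positive root λ* > 0. -/

import Mathlib

open Real MeasureTheory Set

/-- Two-parameter Mittag-Leffler function `E_{α,β}(t) = Σ t^k / Γ(α k + β)`. -/
noncomputable def mittagLeffler (α β t : ℝ) : ℝ := ∑' k : ℕ, t ^ k / Real.Gamma (α * k + β)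

/-- One-parameter Mittag-Leffler function `E_α = E_{α,1}`. -/
noncomputable def ML (α t : ℝ) : ℝ := mittagLeffler α 1 t

/-- The Riemann-Liouville integral `I^{1-α}(x - x 0)` appearing in the Caputo derivative. -/
noncomputable def caputoKernel (α : ℝ) (x : ℝ → ℝ) (s : ℝ) : ℝ :=
  (1 / Real.Gamma (1 - α)) * ∫ r in (0:ℝ)..s, (s - r) ^ (-α) * (x r - x 0)

/-- Caputo fractional derivative of order `α`. -/
noncomputable def caputo (α : ℝ) (x : ℝ → ℝ) (t : ℝ) : ℝ := deriv (caputoKernel α x) t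


lemma betaR {u v : ℝ} (hu : 0 < u) (hv : 0 < v) :
    IntervalIntegrable (fun x : ℝ => x ^ (u - 1) * (1 - x) ^ (v - 1)) volume 0 1 ∧
    ∫ x in (0:ℝ)..1, x ^ (u - 1) * (1 - x) ^ (v - 1)
      = Real.Gamma u * Real.Gamma v / Real.Gamma (u + v) := by
  have hE : ∀ x ∈ Set.uIcc (0:ℝ) 1, (x : ℂ) ^ ((u:ℂ) - 1) * (1 - (x : ℂ)) ^ ((v:ℂ) - 1)
      = ((x ^ (u - 1) * (1 - x) ^ (v - 1) : ℝ) : ℂ) := by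
    intro x hx
    rw [Set.uIcc_of_le zero_le_one] at hx
    rw [Complex.ofReal_mul, Complex.ofReal_cpow hx.1, Complex.ofReal_cpow (by linarith [hx.2])]
    push_cast
    rfl
  constructor
  · have h := Complex.betaIntegral_convergent (u := u) (v := v) (by simpa) (by simpa)
    have h2 : IntervalIntegrable
        (fun x : ℝ => ((x ^ (u - 1) * (1 - x) ^ (v - 1) : ℝ) : ℂ)) volume 0 1 :=
      h.congr (fun x hx => hE x (Set.uIoc_subset_uIcc hx))
    have h3 := (intervalIntegrable_iff.mp h2).re
    exact intervalIntegrable_iff.mpr (by simpa [IntegrableOn] using h3)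
  · have h := ProbabilityTheory.beta_eq_betaIntegralReal u v hu hv
    rw [ProbabilityTheory.beta, Complex.betaIntegral,
      intervalIntegral.integral_congr hE, intervalIntegral.integral_ofReal, Complex.ofReal_re] at h
    exact h.symm

lemma one_sub_rpow_le {β s : ℝ} (hβ : 0 < β) (hs0 : 0 < s) (hs1 : s < 1) :
    1 - s ^ β ≤ (β + 1) * (1 - s) := by
  rcases le_total 1 β with h | h
  · have := one_add_mul_self_le_rpow_one_add (s := s - 1) (by linarith) h
    have e : (1 + (s - 1)) = s := by ring
    rw [e] at this
    nlinarith
  · have := Real.rpow_le_rpow_of_exponent_ge hs0 hs1.le h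
    rw [Real.rpow_one] at this
    nlinarith

lemma rpow_one_sub_int {α : ℝ} (hα : α ∈ Set.Ioo (0:ℝ) 1) :
    IntervalIntegrable (fun s : ℝ => (1 - s) ^ (-α)) volume 0 1 := by
  have := (betaR (u := 1) (v := 1 - α) one_pos (by linarith [hα.2])).1
  simpa using this

lemma kern_int {α β : ℝ} (hα : α ∈ Set.Ioo (0:ℝ) 1) (hβ : 0 < β) :
    IntervalIntegrable (fun s : ℝ => (1 - s ^ β) * (α * (1 - s) ^ (-α - 1))) volume 0 1 := by
  have hα0 := hα.1
  rw [intervalIntegrable_iff_integrableOn_Ioo_of_le zero_le_one]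
  have h1 : IntegrableOn (fun s : ℝ => (β + 1) * (α * (1 - s) ^ (-α))) (Set.Ioo 0 1) volume := by
    have := (rpow_one_sub_int hα)
    rw [intervalIntegrable_iff_integrableOn_Ioo_of_le zero_le_one] at this
    exact (this.const_mul α).const_mul (β + 1)
  refine Integrable.mono' h1 ?_ ?_
  · apply Measurable.aestronglyMeasurable
    fun_prop
  · refine (ae_restrict_iff' measurableSet_Ioo).mpr (Filter.Eventually.of_forall fun s hs => ?_)
    have hp : 0 < 1 - s := by linarith [hs.2]
    have h2 : s ^ β ≤ 1 := Real.rpow_le_one hs.1.le hs.2.le hβ.le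
    have h3 : 0 < (1 - s) ^ (-α - 1) := Real.rpow_pos_of_pos hp _
    rw [Real.norm_of_nonneg (by apply mul_nonneg <;> [linarith; positivity])]
    have h4 : (1 - s) ^ (-α) = (1 - s) * (1 - s) ^ (-α - 1) := by
      rw [mul_comm, ← Real.rpow_add_one hp.ne']; congr 1; ring
    rw [h4]
    calc _ ≤ ((β + 1) * (1 - s)) * (α * (1 - s) ^ (-α - 1)) :=
          mul_le_mul_of_nonneg_right (one_sub_rpow_le hβ hs.1 hs.2) (by positivity)
      _ = _ := by ring

lemma kern_integral {α β : ℝ} (hα : α ∈ Set.Ioo (0:ℝ) 1) (hβ : 0 < β) :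
    ∫ s in (0:ℝ)..1, (1 - s ^ β) * (α * (1 - s) ^ (-α - 1))
      = Real.Gamma (1 - α) * Real.Gamma (β + 1) / Real.Gamma (β + 1 - α) - 1 := by
  obtain ⟨hα0, hα1⟩ := hα
  obtain ⟨bi, bv⟩ := betaR (u := β) (v := 1 - α) hβ (by linarith)
  have ki := kern_int ⟨hα0, hα1⟩ hβ
  have key := intervalIntegral.integral_eq_sub_of_hasDerivAt_of_tendsto (a := (0:ℝ)) (b := 1)
    (f := fun s : ℝ => (1 - s ^ β) * (1 - s) ^ (-α))
    (f' := fun s : ℝ => (1 - s ^ β) * (α * (1 - s) ^ (-α - 1))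
      - β * (s ^ (β - 1) * (1 - s) ^ (1 - α - 1))) (fa := 1) (fb := 0) zero_lt_one ?_
      (ki.sub (bi.const_mul β)) ?_ ?_
  · rw [intervalIntegral.integral_sub ki (bi.const_mul β), intervalIntegral.integral_const_mul,
      bv] at key
    rw [Real.Gamma_add_one hβ.ne', show β + 1 - α = β + (1 - α) by ring]
    linear_combination key
  · intro s hs
    have hp : 0 < 1 - s := by linarith [hs.2]
    have d1 : HasDerivAt (fun s : ℝ => 1 - s ^ β) (-(β * s ^ (β - 1))) s :=
      (Real.hasDerivAt_rpow_const (Or.inl hs.1.ne')).const_sub 1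
    have d2 : HasDerivAt (fun s : ℝ => (1 - s) ^ (-α)) (-1 * (-α) * (1 - s) ^ (-α - 1)) s :=
      ((hasDerivAt_id s).const_sub 1).rpow_const (Or.inl hp.ne')
    refine (d1.mul d2).congr_deriv ?_
    rw [show 1 - α - 1 = -α by ring]
    ring
  · have : ContinuousAt (fun s : ℝ => (1 - s ^ β) * (1 - s) ^ (-α)) 0 := by
      refine ContinuousAt.mul ?_ ?_
      · exact continuousAt_const.sub (Real.continuousAt_rpow_const _ _ (Or.inr hβ.le))
      · exact (continuousAt_const.sub continuousAt_id).rpow_const (Or.inl (by simp))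
    have h := this.tendsto
    simp only [Real.zero_rpow hβ.ne', sub_zero, Real.one_rpow, mul_one] at h
    exact h.mono_left nhdsWithin_le_nhds
  · have hb : Filter.Tendsto (fun s : ℝ => (β + 1) * (1 - s) ^ (1 - α)) (nhdsWithin 1 (Set.Iio 1))
        (nhds 0) := by
      have : ContinuousAt (fun s : ℝ => (β + 1) * (1 - s) ^ (1 - α)) 1 :=
        continuousAt_const.mul
          ((continuousAt_const.sub continuousAt_id).rpow_const (Or.inr (by linarith)))
      have h := this.tendsto
      simp only [sub_self, Real.zero_rpow (show 1 - α ≠ 0 by linarith), mul_zero] at h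
      exact h.mono_left nhdsWithin_le_nhds
    have hm : Set.Ioo (0:ℝ) 1 ∈ nhdsWithin (1:ℝ) (Set.Iio 1) := Ioo_mem_nhdsLT zero_lt_one
    refine tendsto_of_tendsto_of_tendsto_of_le_of_le' tendsto_const_nhds hb ?_ ?_
    · filter_upwards [hm] with s hs
      have hp : 0 < 1 - s := by linarith [hs.2]
      have h2 : s ^ β ≤ 1 := Real.rpow_le_one hs.1.le hs.2.le hβ.le
      exact mul_nonneg (by linarith) (Real.rpow_pos_of_pos hp _).le
    · filter_upwards [hm] with s hs
      have hp : 0 < 1 - s := by linarith [hs.2]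
      have h4 : (1 - s) ^ (1 - α) = (1 - s) * (1 - s) ^ (-α) := by
        rw [mul_comm, ← Real.rpow_add_one hp.ne']; congr 1; ring
      rw [h4, ← mul_assoc]
      exact mul_le_mul_of_nonneg_right (one_sub_rpow_le hβ hs.1 hs.2)
        (Real.rpow_pos_of_pos hp _).le

/-- the weights -/
noncomputable def JJ (α : ℝ) (k : ℕ) : ℝ :=
  ∫ s in Set.Ioo (0:ℝ) 1, (1 - s ^ (α * k)) * (α * (1 - s) ^ (-α - 1))

lemma JJ_zero (α : ℝ) : JJ α 0 = 0 := by simp [JJ]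

lemma JJ_succ {α : ℝ} (hα : α ∈ Set.Ioo (0:ℝ) 1) (k : ℕ) :
    JJ α (k + 1) = Real.Gamma (1 - α) * Real.Gamma (α * (k + 1 : ℕ) + 1) /
      Real.Gamma (α * k + 1) - 1 := by
  have hα0 := hα.1
  rw [JJ, ← integral_Ioc_eq_integral_Ioo, ← intervalIntegral.integral_of_le zero_le_one,
    kern_integral hα (by positivity)]
  congr 3
  push_cast; ring

lemma JJ_int {α : ℝ} (hα : α ∈ Set.Ioo (0:ℝ) 1) (k : ℕ) :
    IntegrableOn (fun s : ℝ => (1 - s ^ (α * k)) * (α * (1 - s) ^ (-α - 1))) (Set.Ioo 0 1) := by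
  rcases k with _ | k
  · simp
  · have hα0 := hα.1
    have := kern_int hα (β := α * (k + 1 : ℕ)) (by positivity)
    rwa [intervalIntegrable_iff_integrableOn_Ioo_of_le zero_le_one] at this

lemma extremum {α : ℝ} (hα : α ∈ Set.Ioo (0:ℝ) 1) (d : ℕ → ℝ)
    (hd : Summable fun k => |d k| * JJ α k)
    (h : ∀ s ∈ Set.Ioo (0:ℝ) 1, ∑' k : ℕ, d k * (1 - s ^ (α * k)) ≤ 0) :
    ∑' k, d k * JJ α k ≤ 0 := by
  have hα0 := hα.1
  have H := hasSum_integral_of_summable_integral_norm (μ := volume.restrict (Set.Ioo (0:ℝ) 1))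
    (F := fun (k : ℕ) (s : ℝ) => d k * ((1 - s ^ (α * k)) * (α * (1 - s) ^ (-α - 1))))
    (fun k => (JJ_int hα k).const_mul (d k)) ?_
  · simp only [integral_const_mul] at H
    change HasSum (fun k => d k * JJ α k) _ at H
    rw [H.tsum_eq]
    refine setIntegral_nonpos measurableSet_Ioo fun s hs => ?_
    have hp : 0 < 1 - s := by linarith [hs.2]
    have h3 : 0 < (1 - s) ^ (-α - 1) := Real.rpow_pos_of_pos hp _
    simp only [← mul_assoc]
    rw [tsum_mul_right, tsum_mul_right]
    exact mul_nonpos_of_nonpos_of_nonneg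
      (mul_nonpos_of_nonpos_of_nonneg (h s hs) hα0.le) h3.le
  · refine hd.congr fun k => ?_
    rw [JJ, ← integral_const_mul]
    refine setIntegral_congr_fun measurableSet_Ioo fun s hs => ?_
    have hp : 0 < 1 - s := by linarith [hs.2]
    have h2 : s ^ (α * k) ≤ 1 := Real.rpow_le_one hs.1.le hs.2.le (by positivity)
    have h3 : 0 < (1 - s) ^ (-α - 1) := Real.rpow_pos_of_pos hp _
    simp only [norm_mul, Real.norm_eq_abs]
    rw [abs_of_nonneg (show 0 ≤ 1 - s ^ (α * k) by linarith), abs_of_pos hα0, abs_of_pos h3]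

lemma gpos {α : ℝ} (hα : α ∈ Set.Ioo (0:ℝ) 1) (k : ℕ) : 0 < Real.Gamma (α * k + 1) := by
  have hα0 := hα.1
  exact Real.Gamma_pos_of_pos (by positivity)

lemma gratio {α : ℝ} (hα : α ∈ Set.Ioo (0:ℝ) 1) (k : ℕ) :
    Real.Gamma (α * k + 1) * (α * (k + 1)) ^ α ≤ Real.Gamma (α * (k + 1 : ℕ) + 1) := by
  obtain ⟨hα0, hα1⟩ := hα
  have hy : 0 < α * (k + 1) := by positivity
  have h := Real.Gamma_mul_add_mul_le_rpow_Gamma_mul_rpow_Gamma (s := α * (k + 1))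
    (t := α * (k + 1) + 1) (a := α) (b := 1 - α) hy (by positivity) hα0 (by linarith) (by ring)
  have g1 := Real.Gamma_pos_of_pos hy
  rw [Real.Gamma_add_one hy.ne', Real.mul_rpow hy.le g1.le] at h
  rw [show α * (α * ((k:ℝ) + 1)) + (1 - α) * (α * (k + 1) + 1) = α * k + 1 by ring] at h
  push_cast
  rw [Real.Gamma_add_one hy.ne']
  calc _ ≤ (Real.Gamma (α * (k + 1)) ^ α * ((α * (k + 1)) ^ (1 - α) *
          Real.Gamma (α * (k + 1)) ^ (1 - α))) * (α * (k + 1)) ^ α :=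
        mul_le_mul_of_nonneg_right h (by positivity)
    _ = ((α * (k + 1)) ^ (1 - α) * (α * (k + 1)) ^ α) * (Real.Gamma (α * (k + 1)) ^ α *
          Real.Gamma (α * (k + 1)) ^ (1 - α)) := by ring
    _ = _ := by
      rw [← Real.rpow_add hy, ← Real.rpow_add g1]; simp

lemma ml_summable {α : ℝ} (hα : α ∈ Set.Ioo (0:ℝ) 1) (x : ℝ) :
    Summable fun k : ℕ => x ^ k / Real.Gamma (α * k + 1) := by
  have hα0 := hα.1
  refine summable_of_ratio_norm_eventually_le (r := 1/2) (by norm_num) ?_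
  have ht : Filter.Tendsto (fun k : ℕ => (α * ((k:ℝ) + 1)) ^ α) Filter.atTop Filter.atTop := by
    refine (tendsto_rpow_atTop hα0).comp ?_
    refine Filter.Tendsto.const_mul_atTop hα0 ?_
    exact Filter.tendsto_atTop_add_const_right _ _ tendsto_natCast_atTop_atTop
  filter_upwards [ht.eventually_ge_atTop (2 * |x|)] with k hk
  have g0 := gpos hα k
  have g1 := gpos hα (k + 1)
  have g2 := gratio hα k
  rw [norm_div, norm_div, norm_pow, norm_pow, Real.norm_eq_abs, Real.norm_of_nonneg g0.le,
    Real.norm_of_nonneg g1.le]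
  have h3 : Real.Gamma (α * k + 1) * (2 * |x|) ≤ Real.Gamma (α * (k + 1 : ℕ) + 1) :=
    (mul_le_mul_of_nonneg_left hk g0.le).trans g2
  rw [← mul_div_assoc, div_le_div_iff₀ g1 g0, pow_succ]
  have hx : 0 ≤ |x| ^ k := by positivity
  nlinarith [mul_le_mul_of_nonneg_left h3 hx]

lemma ml_hasSum {α : ℝ} (hα : α ∈ Set.Ioo (0:ℝ) 1) (x : ℝ) :
    HasSum (fun k : ℕ => x ^ k / Real.Gamma (α * k + 1)) (ML α x) :=
  (ml_summable hα x).hasSum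

lemma ml_zero (α : ℝ) : ML α 0 = 1 := by
  rw [ML, mittagLeffler, tsum_eq_single 0]
  · simp
  · intro k hk; simp [hk]

lemma ml_cont {α : ℝ} (hα : α ∈ Set.Ioo (0:ℝ) 1) : Continuous (ML α) := by
  rw [continuous_iff_continuousAt]
  intro x
  have : ContinuousOn (ML α) (Set.Icc (-(|x| + 1)) (|x| + 1)) := by
    refine continuousOn_tsum (u := fun k : ℕ => (|x| + 1) ^ k / Real.Gamma (α * k + 1))
      (fun k => by fun_prop) (ml_summable hα _) fun k y hy => ?_
    have g0 := gpos hα k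
    rw [norm_div, norm_pow, Real.norm_of_nonneg g0.le, Real.norm_eq_abs]
    have := abs_le.mpr hy
    gcongr
  refine this.continuousAt (Icc_mem_nhds ?_ ?_)
  · linarith [neg_abs_le x]
  · linarith [le_abs_self x]

lemma ml_JJ {α : ℝ} (hα : α ∈ Set.Ioo (0:ℝ) 1) (x : ℝ) :
    HasSum (fun k : ℕ => x ^ k / Real.Gamma (α * k + 1) * JJ α k)
      (Real.Gamma (1 - α) * x * ML α x - (ML α x - 1)) := by
  rw [← hasSum_nat_add_iff' 1]
  have h1 := (hasSum_nat_add_iff' 1).mpr (ml_hasSum hα x)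
  have h2 := ((ml_hasSum hα x).mul_left (Real.Gamma (1 - α) * x)).sub h1
  simp only [Finset.range_one, Finset.sum_singleton, JJ_zero, mul_zero, sub_zero, pow_zero,
    Nat.cast_zero, zero_add, Real.Gamma_one, div_one] at h2 ⊢
  convert h2 using 2 with k
  have g0 := gpos hα k
  have g1 := gpos hα (k + 1)
  rw [JJ_succ hα, pow_succ]
  field_simp

lemma ml_diff {α : ℝ} (hα : α ∈ Set.Ioo (0:ℝ) 1) (x s : ℝ) (hs : 0 < s) :
    HasSum (fun k : ℕ => x ^ k / Real.Gamma (α * k + 1) * (1 - s ^ (α * k)))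
      (ML α x - ML α (x * s ^ α)) := by
  have h := (ml_hasSum hα x).sub (ml_hasSum hα (x * s ^ α))
  have e : (fun k : ℕ => x ^ k / Real.Gamma (α * k + 1) * (1 - s ^ (α * k))) = fun k : ℕ =>
      x ^ k / Real.Gamma (α * k + 1) - (x * s ^ α) ^ k / Real.Gamma (α * k + 1) := by
    funext k
    rw [Real.rpow_mul hs.le, Real.rpow_natCast, mul_pow]
    ring
  rw [e]
  exact h

lemma JJ_nonneg {α : ℝ} (hα : α ∈ Set.Ioo (0:ℝ) 1) (k : ℕ) : 0 ≤ JJ α k := by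
  have hα0 := hα.1
  refine setIntegral_nonneg measurableSet_Ioo fun s hs => ?_
  have hp : 0 < 1 - s := by linarith [hs.2]
  have h2 : s ^ (α * k) ≤ 1 := Real.rpow_le_one hs.1.le hs.2.le (by positivity)
  have h3 : 0 < (1 - s) ^ (-α - 1) := Real.rpow_pos_of_pos hp _
  exact mul_nonneg (by linarith) (by positivity)

lemma ml_pos {α : ℝ} (hα : α ∈ Set.Ioo (0:ℝ) 1) (x : ℝ) (hx : 0 ≤ x) : 0 < ML α (-x) := by
  by_contra hcon
  push Not at hcon
  have hc : ContinuousOn (fun y => ML α (-y)) (Set.Icc 0 x) :=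
    ((ml_cont hα).comp continuous_neg).continuousOn
  obtain ⟨m, hm, hmin⟩ := isCompact_Icc.exists_isMinOn ⟨0, by simp [hx]⟩ hc
  have hmx : ML α (-m) ≤ 0 := (hmin (Set.right_mem_Icc.mpr hx)).trans hcon
  have hJ := ml_JJ hα (-m)
  have hJ' := ml_JJ hα m
  have E := extremum hα (fun k => (-m) ^ k / Real.Gamma (α * k + 1)) ?_ ?_
  · rw [hJ.tsum_eq] at E
    have g := Real.Gamma_pos_of_pos (show 0 < 1 - α by linarith [hα.2])
    nlinarith [mul_nonneg g.le (mul_nonneg hm.1 (neg_nonneg.mpr hmx))]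
  · refine hJ'.summable.congr fun k => ?_
    rw [abs_div, abs_pow, abs_neg, abs_of_nonneg hm.1, abs_of_pos (gpos hα k)]
  · intro s hs
    rw [(ml_diff hα (-m) s hs.1).tsum_eq]
    have h1 : s ^ α ≤ 1 := Real.rpow_le_one hs.1.le hs.2.le hα.1.le
    have h0 : 0 ≤ s ^ α := Real.rpow_nonneg hs.1.le _
    have := hmin (show m * s ^ α ∈ Set.Icc 0 x from
      ⟨mul_nonneg hm.1 h0, (mul_le_of_le_one_right hm.1 h1).trans hm.2⟩)
    simp only [Set.mem_setOf_eq] at this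
    rw [neg_mul]; linarith

lemma ml_anti {α : ℝ} (hα : α ∈ Set.Ioo (0:ℝ) 1) (p q : ℝ) (hp : 0 ≤ p) (hpq : p ≤ q) :
    ML α (-q) ≤ ML α (-p) := by
  by_contra hcon
  push Not at hcon
  have hc : ContinuousOn (fun t => ML α (-p * t) - ML α (-q * t)) (Set.Icc 0 1) := by
    have := ml_cont hα
    fun_prop
  obtain ⟨m, hm, hmin⟩ := isCompact_Icc.exists_isMinOn ⟨0, by simp⟩ hc
  have hmx : ML α (-p * m) - ML α (-q * m) < 0 := by
    have := hmin (Set.right_mem_Icc.mpr zero_le_one)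
    simp only [Set.mem_setOf_eq, mul_one] at this
    linarith
  have hq := ml_pos hα (q * m) (mul_nonneg (hp.trans hpq) hm.1)
  rw [← neg_mul] at hq
  have hJ := (ml_JJ hα (-p * m)).sub (ml_JJ hα (-q * m))
  have hJ' := (ml_JJ hα (p * m)).add (ml_JJ hα (q * m))
  have E := extremum hα (fun k => (-p * m) ^ k / Real.Gamma (α * k + 1)
    - (-q * m) ^ k / Real.Gamma (α * k + 1)) ?_ ?_
  · simp only [sub_mul] at E
    rw [hJ.tsum_eq] at E
    have g := Real.Gamma_pos_of_pos (show 0 < 1 - α by linarith [hα.2])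
    have k1 := mul_nonneg g.le (mul_nonneg (mul_nonneg hp hm.1) (neg_nonneg.mpr hmx.le))
    have k2 := mul_nonneg g.le (mul_nonneg (mul_nonneg (sub_nonneg.mpr hpq) hm.1) hq.le)
    nlinarith
  · refine Summable.of_nonneg_of_le (fun k => ?_) (fun k => ?_) hJ'.summable
    · exact mul_nonneg (abs_nonneg _) (JJ_nonneg hα k)
    · rw [← add_mul]
      refine mul_le_mul_of_nonneg_right ?_ (JJ_nonneg hα k)
      refine (abs_sub _ _).trans (le_of_eq ?_)
      rw [abs_div, abs_div, abs_pow, abs_pow, abs_mul, abs_mul, abs_neg, abs_neg,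
        abs_of_nonneg hm.1, abs_of_nonneg hp, abs_of_nonneg (hp.trans hpq), abs_of_pos (gpos hα k)]
  · intro s hs
    simp only [sub_mul]
    rw [((ml_diff hα (-p * m) s hs.1).sub (ml_diff hα (-q * m) s hs.1)).tsum_eq]
    have h1 : s ^ α ≤ 1 := Real.rpow_le_one hs.1.le hs.2.le hα.1.le
    have h0 : 0 ≤ s ^ α := Real.rpow_nonneg hs.1.le _
    have := hmin (show m * s ^ α ∈ Set.Icc 0 1 from
      ⟨mul_nonneg hm.1 h0, (mul_le_of_le_one_right hm.1 h1).trans hm.2⟩)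
    simp only [Set.mem_setOf_eq] at this
    rw [mul_assoc, mul_assoc (-q)]; linarith

/-- The characteristic function for the contractivity of fractional neutral FDEs has a
unique positive root. -/
theorem neutral_characteristic_root (α τ a₁ b₁ c₁ k₁ nN : ℝ)
    (hα : α ∈ Set.Ioo (0:ℝ) 1) (hτ : 0 < τ) (ha₁ : a₁ < 0) (hN : 2 * nN ^ 2 < 1)
    (hK0 : 0 ≤ 2 * (b₁ - a₁ * nN ^ 2 + c₁ * k₁ ^ 2 * τ ^ 2))
    (hK : 2 * (b₁ - a₁ * nN ^ 2 + c₁ * k₁ ^ 2 * τ ^ 2) < -a₁) :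
    ∃! lam : ℝ, 0 < lam ∧
      lam + a₁ + 2 * (b₁ - a₁ * nN ^ 2 + c₁ * k₁ ^ 2 * τ ^ 2) / ML α (-(lam * τ ^ α)) = 0 := by
  generalize 2 * (b₁ - a₁ * nN ^ 2 + c₁ * k₁ ^ 2 * τ ^ 2) = K at *
  have hT : 0 < τ ^ α := Real.rpow_pos_of_pos hτ _
  have hpos : ∀ l : ℝ, 0 ≤ l → 0 < ML α (-(l * τ ^ α)) := fun l hl =>
    ml_pos hα _ (mul_nonneg hl hT.le)
  have hmono : ∀ l l' : ℝ, 0 ≤ l → l < l' →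
      l + a₁ + K / ML α (-(l * τ ^ α)) < l' + a₁ + K / ML α (-(l' * τ ^ α)) := by
    intro l l' hl hll
    have h1 := ml_anti hα (l * τ ^ α) (l' * τ ^ α) (mul_nonneg hl hT.le)
      (mul_le_mul_of_nonneg_right hll.le hT.le)
    have h2 := div_le_div_of_nonneg_left hK0 (hpos l' (hl.trans hll.le)) h1
    linarith
  have hc : ContinuousOn (fun l => l + a₁ + K / ML α (-(l * τ ^ α))) (Set.Icc 0 (-a₁)) := by
    have := ml_cont hα
    refine ContinuousOn.add (by fun_prop) (ContinuousOn.div (by fun_prop) (by fun_prop) ?_)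
    intro l hl
    exact (hpos l hl.1).ne'
  have hiv := intermediate_value_Icc (by linarith : (0:ℝ) ≤ -a₁) hc
  have hz : (0:ℝ) ∈ Set.Icc (0 + a₁ + K / ML α (-(0 * τ ^ α)))
      (-a₁ + a₁ + K / ML α (-(-a₁ * τ ^ α))) := by
    constructor
    · rw [zero_mul, neg_zero, ml_zero]; linarith
    · have := div_nonneg hK0 (hpos (-a₁) (by linarith)).le
      linarith
  obtain ⟨l, hl, hl0⟩ := hiv hz
  simp only at hl0
  have hlpos : 0 < l := by
    rcases hl.1.eq_or_lt with h | h
    · rw [← h, zero_mul, neg_zero, ml_zero] at hl0; linarith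
    · exact h
  refine ⟨l, ⟨hlpos, hl0⟩, ?_⟩
  rintro l' ⟨hl'p, hl'0⟩
  rcases lt_trichotomy l' l with h | h | h
  · linarith [hmono l' l hl'p.le h]
  · exact h
  · linarith [hmono l l' hlpos.le h]
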